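/- Discrete state and flow equations for the von Mises model with kinematic hardening: in the plastic case |s^tr| > Y, the return-mapping updates satisfy Δλ > 0, σ_k = ℂ(ε_k − ε^p_k), ε^p_k − ε^p_{k−1} = Δλ·n^tr, β_k − β_{k−1} = a·Δλ·n^tr, and the trial flow direction equals the final flow direction: n^tr = (dev(σ_k) − β_k)/|dev(σ_k) − β_k|. -/

import Mathlib

open Matrix

/-- Frobenius inner product on 3×3 real matrices. -/
noncomputable def frob (σ τ : Matrix (Fin 3) (Fin 3) ℝ) : ℝ := ∑ i, ∑ j, σ i j * τ i j

/-- Frobenius norm. -/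
noncomputable def fnorm (τ : Matrix (Fin 3) (Fin 3) ℝ) : ℝ := Real.sqrt (frob τ τ)

/-- Deviatoric part. -/
noncomputable def devM (τ : Matrix (Fin 3) (Fin 3) ℝ) : Matrix (Fin 3) (Fin 3) ℝ :=
  τ - (Matrix.trace τ / 3) • (1 : Matrix (Fin 3) (Fin 3) ℝ)

/-- The isotropic elasticity tensor `ℂε = K tr(ε) I + 2G dev(ε)`. -/
noncomputable def Celast (K G : ℝ) (ε : Matrix (Fin 3) (Fin 3) ℝ) : Matrix (Fin 3) (Fin 3) ℝ :=
  (K * Matrix.trace ε) • (1 : Matrix (Fin 3) (Fin 3) ℝ) + (2 * G) • devM ε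

theorem trace_devM (τ : Matrix (Fin 3) (Fin 3) ℝ) : Matrix.trace (devM τ) = 0 := by
  simp [devM, Matrix.trace_sub, Matrix.trace_smul]

theorem devM_of_trace_eq_zero {τ : Matrix (Fin 3) (Fin 3) ℝ} (h : Matrix.trace τ = 0) :
    devM τ = τ := by
  simp [devM, h]

theorem devM_sub (σ τ : Matrix (Fin 3) (Fin 3) ℝ) : devM (σ - τ) = devM σ - devM τ := by
  simp only [devM, Matrix.trace_sub]
  module

theorem devM_smul (c : ℝ) (τ : Matrix (Fin 3) (Fin 3) ℝ) : devM (c • τ) = c • devM τ := by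
  simp only [devM, Matrix.trace_smul, smul_eq_mul]
  module

theorem Celast_sub (K G : ℝ) (ε η : Matrix (Fin 3) (Fin 3) ℝ) :
    Celast K G (ε - η) = Celast K G ε - Celast K G η := by
  simp only [Celast, Matrix.trace_sub, devM_sub]
  module

theorem Celast_of_trace_eq_zero (K G : ℝ) {ε : Matrix (Fin 3) (Fin 3) ℝ}
    (h : Matrix.trace ε = 0) : Celast K G ε = (2 * G) • ε := by
  simp [Celast, h, devM_of_trace_eq_zero h]

theorem fnorm_smul (c : ℝ) (τ : Matrix (Fin 3) (Fin 3) ℝ) : fnorm (c • τ) = |c| * fnorm τ := by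
  have h : frob (c • τ) (c • τ) = c ^ 2 * frob τ τ := by
    simp only [frob, Finset.mul_sum, Matrix.smul_apply, smul_eq_mul]
    refine Finset.sum_congr rfl fun i _ => Finset.sum_congr rfl fun j _ => ?_
    ring
  rw [fnorm, h, Real.sqrt_mul (sq_nonneg c), Real.sqrt_sq_eq_abs, fnorm]

/-- Discrete state and flow equations for the von Mises model with kinematic hardening:
in the plastic case the return-mapping updates satisfy `Δλ > 0`, `σₖ = ℂ(εₖ − εₖᵖ)`,
`εₖᵖ − εₖ₋₁ᵖ = Δλ n^tr`, `βₖ − βₖ₋₁ = a Δλ n^tr`, and the trial flow direction equals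
the final flow direction. -/
theorem vonMises_discrete_flow (K G a Y : ℝ) (hK : 0 < K) (hG : 0 < G) (ha : 0 < a)
    (hY : 0 < Y) (εk εp βp : Matrix (Fin 3) (Fin 3) ℝ)
    (hεk : εk.IsSymm) (hεp : εp.IsSymm) (hβp : βp.IsSymm) (hβtr : Matrix.trace βp = 0)
    (σtr str ntr σk βk εpk : Matrix (Fin 3) (Fin 3) ℝ) (Δlam : ℝ)
    (hσtr : σtr = Celast K G (εk - εp))
    (hstr : str = devM σtr - βp)
    (hplastic : Y < fnorm str)
    (hntr : ntr = (fnorm str)⁻¹ • str)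
    (hΔlam : Δlam = (fnorm str - Y) / (2 * G + a))
    (hσk : σk = σtr - (2 * G * Δlam) • ntr)
    (hβk : βk = βp + (a * Δlam) • ntr)
    (hεpk : εpk = εp + Δlam • ntr) :
    0 < Δlam ∧ σk = Celast K G (εk - εpk) ∧ εpk - εp = Δlam • ntr ∧
      βk - βp = (a * Δlam) • ntr ∧
      ntr = (fnorm (devM σk - βk))⁻¹ • (devM σk - βk) := by
  have hr : 0 < fnorm str := hY.trans hplastic
  have hGa : 0 < 2 * G + a := by positivity
  have htr : Matrix.trace ntr = 0 := by
    rw [hntr, hstr, Matrix.trace_smul, Matrix.trace_sub, trace_devM, hβtr]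
    simp
  have hnorm : fnorm ntr = 1 := by
    rw [hntr, fnorm_smul, abs_of_pos (inv_pos.mpr hr), inv_mul_cancel₀ hr.ne']
  have hstr_eq : str = fnorm str • ntr := by
    rw [hntr, smul_smul, mul_inv_cancel₀ hr.ne', one_smul]
  have hfinal : devM σk - βk = Y • ntr := by
    have hlam : (2 * G + a) * Δlam = fnorm str - Y := by
      rw [hΔlam]
      field_simp
    have hdev : devM σtr = fnorm str • ntr + βp := by
      rw [← hstr_eq, hstr, sub_add_cancel]
    have hY_eq : Y = fnorm str - (2 * G + a) * Δlam := by linarith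
    rw [hσk, hβk, devM_sub, devM_smul, devM_of_trace_eq_zero htr, hdev]
    rw [hY_eq]
    module
  refine ⟨?_, ?_, ?_, ?_, ?_⟩
  · rw [hΔlam]
    exact div_pos (sub_pos.mpr hplastic) hGa
  · have hlamtr : Matrix.trace (Δlam • ntr) = 0 := by
      rw [Matrix.trace_smul, htr, smul_zero]
    rw [hεpk, ← sub_sub, Celast_sub, Celast_of_trace_eq_zero K G hlamtr, smul_smul, hσk, hσtr]
  · rw [hεpk, add_sub_cancel_left]
  · rw [hβk, add_sub_cancel_left]
  · rw [hfinal, fnorm_smul, hnorm, mul_one, abs_of_pos hY, smul_smul, inv_mul_cancel₀ hY.ne',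
      one_smul]
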